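/- Let p be an odd prime, F = {(t, t²) : t ∈ Z_p} ⊆ Z_p², f = p^{−1/2}·1_F, and let g = f̂ be the Fourier transform of f on Z_p². Then the support E = {m ∈ Z_p² : g(m) ≠ 0} has cardinality |E| = p² − p + 1. -/

import Mathlib

open Finset

/-- The fixed character `χ(t) = e^{2πi t/p}` of `ℤ/p`. -/
noncomputable def chi (p : ℕ) (t : ZMod p) : ℂ :=
  Complex.exp (2 * Real.pi * Complex.I * (t.val : ℂ) / (p : ℂ))

/-- The dot product on `ℤ_p^d`. -/
def dotp {p d : ℕ} (x y : Fin d → ZMod p) : ZMod p := ∑ i, x i * y i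

/-- The Gabor (time-frequency shifted) function `x ↦ g(x-a) χ(x·b)`. -/
noncomputable def gabor {p d : ℕ} (g : (Fin d → ZMod p) → ℂ) (a b : Fin d → ZMod p) :
    (Fin d → ZMod p) → ℂ :=
  fun x => g (x - a) * chi p (dotp x b)

/-- The inner product of `L²` with counting measure on a finite type. -/
noncomputable def innerC {V : Type*} [Fintype V] (f g : V → ℂ) : ℂ :=
  ∑ x, f x * (starRingEnd ℂ) (g x)

/-- `𝒢(g, A, B)` is an orthonormal basis of `L²(ℤ_p^d)`: the family is orthonormal and
every function is a linear combination of its members. -/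
def IsGaborONB {p d : ℕ} [NeZero p] (g : (Fin d → ZMod p) → ℂ)
    (A B : Finset (Fin d → ZMod p)) : Prop :=
  (∀ a ∈ A, ∀ b ∈ B, ∀ a' ∈ A, ∀ b' ∈ B,
    innerC (gabor g a b) (gabor g a' b') = if a = a' ∧ b = b' then 1 else 0)
  ∧ (∀ f : (Fin d → ZMod p) → ℂ, ∃ c : (Fin d → ZMod p) → (Fin d → ZMod p) → ℂ,
      f = fun x => ∑ a ∈ A, ∑ b ∈ B, c a b * gabor g a b x)

/-- `(E, B)` is a spectral pair: the characters indexed by `B` are pairwise orthogonal in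
`L²(E)` and span it. -/
def IsSpectralPair {p d : ℕ} [NeZero p] (E B : Finset (Fin d → ZMod p)) : Prop :=
  (∀ b ∈ B, ∀ b' ∈ B, b ≠ b' → ∑ x ∈ E, chi p (dotp x (b - b')) = 0)
  ∧ (∀ f : (Fin d → ZMod p) → ℂ, ∃ c : (Fin d → ZMod p) → ℂ,
      ∀ x ∈ E, f x = ∑ b ∈ B, c b * chi p (dotp x b))

/-- `(E, A)` is a tiling pair: `Σ_{a∈A} 1_E(x-a) = 1` for every `x`. -/
def IsTilingPair {p d : ℕ} [NeZero p] (E A : Finset (Fin d → ZMod p)) : Prop :=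
  ∀ x : Fin d → ZMod p, (∑ a ∈ A, if x - a ∈ E then (1 : ℕ) else 0) = 1

/-- The Fourier transform `ĝ(m) = p^{-d} Σ_x χ(-x·m) g(x)` on `ℤ_p^d`. -/
noncomputable def ft {p d : ℕ} [NeZero p] (g : (Fin d → ZMod p) → ℂ)
    (m : Fin d → ZMod p) : ℂ :=
  ((p : ℂ) ^ d)⁻¹ * ∑ x, chi p (-(dotp x m)) * g x

/-- A quadratic exponential sum over a finite field of odd characteristic times the sum with
inverted phase is the cardinality of the field. -/
lemma quadratic_sum_mul_quadratic_sum_neg {K R : Type*} [Field K] [Fintype K] [DecidableEq K]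
    [CommRing R] [IsDomain R] {ψ : AddChar K R} (hψ : ψ.IsPrimitive) (h2 : (2 : K) ≠ 0)
    {a : K} (ha : a ≠ 0) (b : K) :
    (∑ s, ψ (a * s ^ 2 + b * s)) * ∑ t, ψ (-(a * t ^ 2 + b * t)) = Fintype.card K := by
  have inner (u : K) : ∑ t, ψ (t * (2 * a * u)) = if u = 0 then (Fintype.card K : R) else 0 := by
    rw [AddChar.sum_mulShift _ hψ]
    simp [h2, ha]
  calc
    _ = ∑ t, ∑ s, ψ (a * s ^ 2 + b * s) * ψ (-(a * t ^ 2 + b * t)) := by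
      rw [Finset.sum_mul_sum, Finset.sum_comm]
    _ = ∑ t, ∑ u, ψ (a * u ^ 2 + b * u) * ψ (t * (2 * a * u)) := by
      refine Finset.sum_congr rfl fun t _ => ?_
      rw [← Equiv.sum_comp (Equiv.addRight t)]
      refine Finset.sum_congr rfl fun u _ => ?_
      rw [← AddChar.map_add_eq_mul, ← AddChar.map_add_eq_mul, Equiv.coe_addRight]
      congr 1
      ring
    _ = Fintype.card K := by
      rw [Finset.sum_comm]
      simp [← Finset.mul_sum, inner]

lemma chi_eq_stdAddChar (p : ℕ) [NeZero p] (t : ZMod p) : chi p t = ZMod.stdAddChar t := by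
  rw [ZMod.stdAddChar_apply, ZMod.toCircle_apply, chi]

/-- The sum of `χ` along the parabola vanishes exactly at the nonzero horizontal frequencies. -/
lemma sum_chi_parabola_eq_zero_iff {p : ℕ} [Fact p.Prime] (hp : Odd p) (m : Fin 2 → ZMod p) :
    ∑ t : ZMod p, chi p (-(dotp ![t, t ^ 2] m)) = 0 ↔ m 1 = 0 ∧ m 0 ≠ 0 := by
  have hψ := ZMod.isPrimitive_stdAddChar p
  have hp0 : (p : ℂ) ≠ 0 := Nat.cast_ne_zero.mpr (NeZero.ne p)
  have h2 : (2 : ZMod p) ≠ 0 := by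
    refine Ring.two_ne_zero ?_
    rw [ZMod.ringChar_zmod_n]
    rintro rfl
    exact absurd hp (by decide)
  simp only [chi_eq_stdAddChar, dotp, Fin.sum_univ_two, Matrix.cons_val_zero, Matrix.cons_val_one]
  by_cases h1 : m 1 = 0
  · have := AddChar.sum_mulShift (-m 0) hψ
    simp only [h1, mul_zero, add_zero, ← mul_neg, this]
    simp [hp0]
  · simp only [h1, false_and, iff_false]
    intro h
    have key := quadratic_sum_mul_quadratic_sum_neg hψ h2 (neg_ne_zero.mpr h1) (-m 0)
    have : ∑ s, ZMod.stdAddChar (-m 1 * s ^ 2 + -m 0 * s) = 0 := by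
      rw [← h]
      refine Finset.sum_congr rfl fun s _ => ?_
      congr 1
      ring
    rw [this, zero_mul, ZMod.card] at key
    exact hp0 key.symm

/-- The nonzero horizontal vectors of the plane number `p - 1`. -/
lemma card_filter_nonzero_horizontal (p : ℕ) [NeZero p] :
    #{m : Fin 2 → ZMod p | m 1 = 0 ∧ m 0 ≠ 0} = p - 1 := by
  have himage : ({m : Fin 2 → ZMod p | m 1 = 0 ∧ m 0 ≠ 0} : Finset _) =
      (univ.erase (0 : ZMod p)).image fun t => ![t, 0] := by
    ext m
    simp only [mem_filter, mem_univ, true_and, mem_image, mem_erase, and_true]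
    constructor
    · rintro ⟨h1, h0⟩
      refine ⟨m 0, h0, ?_⟩
      ext i
      fin_cases i <;> simp [h1]
    · rintro ⟨t, ht, rfl⟩
      simpa using ht
  rw [himage, card_image_of_injective _ fun s t h => by simpa using congrFun h 0,
    card_erase_of_mem (mem_univ _), card_univ, ZMod.card]

/-- For `F = {(t, t²) : t ∈ ℤ_p}` (`p` an odd prime), `f = p^{-1/2} 1_F`
and `g = f̂`, the support `E` of `g` has cardinality `p² - p + 1`. -/
theorem card_support_fourier_of_parabola
    (p : ℕ) [Fact p.Prime] (hp : Odd p)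
    (F : Finset (Fin 2 → ZMod p))
    (hF : F = Finset.univ.image (fun t : ZMod p => ![t, t ^ 2]))
    (f : (Fin 2 → ZMod p) → ℂ)
    (hf : ∀ x, f x = ((Real.sqrt p : ℝ) : ℂ)⁻¹ * (if x ∈ F then 1 else 0))
    (E : Finset (Fin 2 → ZMod p))
    (hE : E = Finset.univ.filter (fun m => ft f m ≠ 0)) :
    E.card = p ^ 2 - p + 1 := by
  have hp0 : (p : ℂ) ≠ 0 := Nat.cast_ne_zero.mpr (NeZero.ne p)
  have hsqrt : ((Real.sqrt p : ℝ) : ℂ)⁻¹ ≠ 0 := by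
    simpa using NeZero.ne p
  have hft (m : Fin 2 → ZMod p) : ft f m =
      ((p : ℂ) ^ 2)⁻¹ * (((Real.sqrt p : ℝ) : ℂ)⁻¹ *
        ∑ t : ZMod p, chi p (-(dotp ![t, t ^ 2] m))) := by
    have hsum : ∑ t : ZMod p, chi p (-(dotp ![t, t ^ 2] m)) = ∑ x ∈ F, chi p (-(dotp x m)) := by
      rw [hF, sum_image fun s _ t _ h => by simpa using congrFun h 0]
    rw [ft, hsum, mul_sum (s := F),
      ← sum_subset (subset_univ F) fun x _ hx => by rw [hf, if_neg hx, mul_zero, mul_zero]]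
    congr 1
    refine sum_congr rfl fun x hx => ?_
    rw [hf, if_pos hx, mul_one, mul_comm]
  have hEc : E = ({m : Fin 2 → ZMod p | m 1 = 0 ∧ m 0 ≠ 0} : Finset _)ᶜ := by
    rw [hE, compl_filter]
    refine filter_congr fun m _ => not_congr ?_
    rw [hft, mul_eq_zero_iff_left (inv_ne_zero (pow_ne_zero 2 hp0)),
      mul_eq_zero_iff_left hsqrt, sum_chi_parabola_eq_zero_iff hp]
  rw [hEc, card_compl, card_filter_nonzero_horizontal, Fintype.card_fun, ZMod.card, Fintype.card_fin]
  have hpos : 1 ≤ p := NeZero.one_le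
  have hle : p ≤ p ^ 2 := Nat.le_self_pow two_ne_zero p
  omega
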